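/- Let c ≥ 1 and o > c be natural numbers. For every integer i with ⌈o/c⌉ ≤ i ≤ o, there exists a list of exactly i positive integers, each at most c, whose sum is o. Hence the set of image counts consistent with an observed total of o iterations under per-image cap c is exactly the integer interval [⌈o/c⌉, o]. -/

import Mathlib

/-- A natural number between `i` and `i * c` is a sum of `i` naturals lying in `[1, c]`. -/
theorem exists_list_sum_eq_of_le_of_le_mul {c : ℕ} (hc : 1 ≤ c) {i o : ℕ} (hio : i ≤ o)
    (hoi : o ≤ i * c) :
    ∃ l : List ℕ, l.length = i ∧ (∀ x ∈ l, 1 ≤ x ∧ x ≤ c) ∧ l.sum = o := by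
  induction i generalizing o with
  | zero => exact ⟨[], rfl, by simp, by simp at hoi ⊢; omega⟩
  | succ i ih =>
    have hi : i ≤ i * c := Nat.le_mul_of_pos_right i hc
    rw [Nat.succ_mul] at hoi
    obtain ⟨l, hlen, hmem, hsum⟩ := ih (o := o - min c (o - i)) (by omega) (by omega)
    refine ⟨min c (o - i) :: l, by simp [hlen], ?_, by rw [List.sum_cons, hsum]; omega⟩
    rintro x (_ | ⟨_, hx⟩)
    · omega
    · exact hmem x hx

/-- Let `c ≥ 1` and `o > c`. For every `i` with `⌈o/c⌉ ≤ i ≤ o` there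
is a list of exactly `i` positive integers, each at most `c`, summing to `o`; hence the
set of image counts consistent with an observed total of `o` iterations under per-image
cap `c` is exactly the integer interval `[⌈o/c⌉, o]`. -/
theorem snail_consistent_counts_interval (c o : ℕ) (hc : 1 ≤ c) (ho : c < o) :
    (∀ i : ℕ, o ⌈/⌉ c ≤ i → i ≤ o →
      ∃ l : List ℕ, l.length = i ∧ (∀ x ∈ l, 1 ≤ x ∧ x ≤ c) ∧ l.sum = o) ∧
    {i : ℕ | ∃ l : List ℕ, l.length = i ∧ (∀ x ∈ l, 1 ≤ x ∧ x ≤ c) ∧ l.sum = o}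
      = Set.Icc (o ⌈/⌉ c) o := by
  have hiff (i : ℕ) : o ⌈/⌉ c ≤ i ↔ o ≤ i * c := by
    rw [ceilDiv_le_iff_le_mul hc, mul_comm]
  have hexists (i : ℕ) (hi : o ⌈/⌉ c ≤ i) (hio : i ≤ o) :=
    exists_list_sum_eq_of_le_of_le_mul hc hio ((hiff i).1 hi)
  refine ⟨hexists, Set.Subset.antisymm ?_ fun i hi => hexists i hi.1 hi.2⟩
  rintro i ⟨l, rfl, hl, rfl⟩
  refine ⟨(hiff _).2 ?_, ?_⟩
  · simpa using List.sum_le_card_nsmul l c fun x hx => (hl x hx).2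
  · simpa using List.card_nsmul_le_sum l 1 fun x hx => (hl x hx).1
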